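/- For all ξ, η ∈ ℂ, the determinant of the 3×3 matrix with rows (∂C₆/∂ξ, ∂C₆/∂η, 2·C₆), (∂C₁₂/∂ξ, ∂C₁₂/∂η, 4·C₁₂), (∂𝔠₁₂/∂ξ, ∂𝔠₁₂/∂η, 4·𝔠₁₂) equals 144·C₉·C₁₈. -/

import Mathlib

noncomputable section

/-- Affine Hessian invariant C₆. -/
def C₆ : ℂ → ℂ → ℂ := fun ξ η => ξ^6 + η^6 + 1 - 10*(ξ^3*η^3 + ξ^3 + η^3)
/-- Affine Hessian invariant C₉. -/
def C₉ : ℂ → ℂ → ℂ := fun ξ η => (ξ^3 - η^3)*(η^3 - 1)*(1 - ξ^3)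
/-- Affine Hessian invariant C₁₂. -/
def C₁₂ : ℂ → ℂ → ℂ := fun ξ η => (ξ^3 + η^3 + 1)*((ξ^3 + η^3 + 1)^3 + 216*ξ^3*η^3)
/-- Affine Hessian invariant 𝔠₁₂. -/
def 𝔠₁₂ : ℂ → ℂ → ℂ := fun ξ η => ξ*η*(27*ξ^3*η^3 - (ξ^3 + η^3 + 1)^3)
/-- Affine Hessian invariant C₁₈. -/
def C₁₈ : ℂ → ℂ → ℂ := fun ξ η => (ξ^3 + η^3 + 1)^6 - 540*ξ^3*η^3*(ξ^3 + η^3 + 1)^3 - 5832*ξ^6*η^6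

/-- Complex partial derivative in the first variable. -/
def pdξ (f : ℂ → ℂ → ℂ) (ξ η : ℂ) : ℂ := deriv (fun t => f t η) ξ
/-- Complex partial derivative in the second variable. -/
def pdη (f : ℂ → ℂ → ℂ) (ξ η : ℂ) : ℂ := deriv (fun t => f ξ t) η

theorem hasDerivAt_cube_add (a b : ℂ) (t : ℂ) :
    HasDerivAt (fun t : ℂ => t^3 + a^3 + b) (3*t^2) t := by
  simpa using ((hasDerivAt_pow 3 t).add_const (a^3)).add_const b

theorem C₆_comm (ξ η : ℂ) : C₆ ξ η = C₆ η ξ := by simp only [C₆]; ring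

theorem C₁₂_comm (ξ η : ℂ) : C₁₂ ξ η = C₁₂ η ξ := by simp only [C₁₂]; ring

theorem 𝔠₁₂_comm (ξ η : ℂ) : 𝔠₁₂ ξ η = 𝔠₁₂ η ξ := by simp only [𝔠₁₂]; ring

/-- For a symmetric function the two partial derivatives are exchanged by swapping variables. -/
theorem pdη_eq_pdξ_swap {f : ℂ → ℂ → ℂ} (hf : ∀ ξ η, f ξ η = f η ξ) (ξ η : ℂ) :
    pdη f ξ η = pdξ f η ξ := by
  simp only [pdη, pdξ, hf ξ]

theorem pdξ_C₆ (ξ η : ℂ) : pdξ C₆ ξ η = 6*ξ^5 - 30*ξ^2*(η^3 + 1) := by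
  have h3 := hasDerivAt_pow 3 ξ
  have h := (((hasDerivAt_pow 6 ξ).add_const (η^6)).add_const 1).sub
    ((((h3.mul_const (η^3)).add h3).add_const (η^3)).const_mul 10)
  refine HasDerivAt.deriv (h.congr_deriv ?_)
  push_cast
  ring

theorem pdξ_C₁₂ (ξ η : ℂ) :
    pdξ C₁₂ ξ η = 12*ξ^2*((ξ^3 + η^3 + 1)^3 + 54*η^3*(2*ξ^3 + η^3 + 1)) := by
  have hS := hasDerivAt_cube_add η 1 ξ
  have h := hS.mul ((hS.pow 3).add
    (((hasDerivAt_pow 3 ξ).const_mul 216).mul_const (η^3)))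
  refine HasDerivAt.deriv (h.congr_deriv ?_)
  simp only [Pi.add_apply, Pi.pow_apply]
  push_cast
  ring

theorem pdξ_𝔠₁₂ (ξ η : ℂ) :
    pdξ 𝔠₁₂ ξ η = η*(108*ξ^3*η^3 - (ξ^3 + η^3 + 1)^3 - 9*ξ^3*(ξ^3 + η^3 + 1)^2) := by
  have hS := hasDerivAt_cube_add η 1 ξ
  have h := ((hasDerivAt_id' ξ).mul_const η).mul
    ((((hasDerivAt_pow 3 ξ).const_mul 27).mul_const (η^3)).sub (hS.pow 3))
  refine HasDerivAt.deriv (h.congr_deriv ?_)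
  simp only [Pi.sub_apply, Pi.pow_apply]
  push_cast
  ring

theorem det_C6_C12_fC12 (ξ η : ℂ) :
    Matrix.det !![pdξ C₆ ξ η, pdη C₆ ξ η, 2 * C₆ ξ η;
                  pdξ C₁₂ ξ η, pdη C₁₂ ξ η, 4 * C₁₂ ξ η;
                  pdξ 𝔠₁₂ ξ η, pdη 𝔠₁₂ ξ η, 4 * 𝔠₁₂ ξ η]
      = 144 * C₉ ξ η * C₁₈ ξ η := by
  rw [pdη_eq_pdξ_swap C₆_comm, pdη_eq_pdξ_swap C₁₂_comm, pdη_eq_pdξ_swap 𝔠₁₂_comm]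
  simp only [pdξ_C₆, pdξ_C₁₂, pdξ_𝔠₁₂, Matrix.det_fin_three, Matrix.of_apply, Matrix.cons_val]
  simp only [C₆, C₉, C₁₂, 𝔠₁₂, C₁₈]
  ring
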